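/- Let μ be the Haar measure on the additive group of ℚ_2 normalized so that ℤ_2 has measure 1. Then ∫_{E ∩ Y_1} log(|1 − y|_2 / |y|_2) · |1 − y|_2^{−1} |y|_2^{−1/2} dμ(y) = (1/2) log 2. -/

import Mathlib

open MeasureTheory

/-- The unit part `u = y · 2^{-v₂(y)}` of a 2-adic number `y`. -/
noncomputable def unitPart (y : ℚ_[2]) : ℚ_[2] := y * (2 : ℚ_[2]) ^ (-y.valuation)

/-- `Y₁ = {y ∈ ℚ₂^× : v₂(y) even, u ≡ 1 (mod 8)}`. -/
def Yone : Set ℚ_[2] := {y | y ≠ 0 ∧ Even y.valuation ∧ ‖unitPart y - 1‖ ≤ 8⁻¹}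

/-- `E = {y ∈ ℚ₂, y ≠ 1 : v₂(1-y) even, v₂(1-y) ≤ 2}`. -/
def Eset : Set ℚ_[2] := {y | y ≠ 1 ∧ Even (1 - y).valuation ∧ (1 - y).valuation ≤ 2}

open Metric

lemma norm_two_padic : ‖(2 : ℚ_[2])‖ = 2⁻¹ := by
  simpa using Padic.norm_p (p := 2)

lemma norm_four_zpow_padic (k : ℤ) : ‖(4 : ℚ_[2]) ^ k‖ = 4 ^ (-k) := by
  have h : ‖(4 : ℚ_[2])‖ = 4⁻¹ := by
    rw [show (4 : ℚ_[2]) = 2 * 2 by norm_num, norm_mul, norm_two_padic]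
    norm_num
  rw [norm_zpow, h, inv_zpow, zpow_neg]

/-- A 2-adic number has valuation `n` as soon as its norm is `2 ^ (-n)`. -/
lemma valuation_eq_of_norm_eq {x : ℚ_[2]} {n : ℤ} (h : ‖x‖ = 2 ^ (-n)) :
    x ≠ 0 ∧ x.valuation = n := by
  have hx : x ≠ 0 := by
    rintro rfl
    rw [norm_zero] at h
    exact (zpow_pos (by norm_num : (0 : ℝ) < 2) _).ne h
  refine ⟨hx, ?_⟩
  rw [Padic.norm_eq_zpow_neg_valuation hx, Nat.cast_ofNat] at h
  have := zpow_right_injective₀ (by norm_num : (0 : ℝ) < 2) (by norm_num) h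
  simpa using this

lemma four_zpow_eq (k : ℤ) : (4 : ℝ) ^ k = 2 ^ (2 * k) := by
  rw [zpow_mul]
  norm_num

/-- The residue field of `ℤ₂` has the two elements `0` and `1`. -/
lemma norm_le_half_or_norm_sub_one_le_half {x : ℚ_[2]} (hx : ‖x‖ ≤ 1) :
    ‖x‖ ≤ 2⁻¹ ∨ ‖x - 1‖ ≤ 2⁻¹ := by
  have key (z : ℤ_[2]) (hz : ‖z‖ < 1) : ‖(z : ℚ_[2])‖ ≤ 2⁻¹ := by
    obtain ⟨w, rfl⟩ := (PadicInt.norm_lt_one_iff_dvd z).1 hz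
    have hw := w.norm_le_one
    rw [PadicInt.norm_def] at hw
    rw [PadicInt.coe_mul, PadicInt.coe_natCast, Nat.cast_ofNat, norm_mul, norm_two_padic]
    linarith
  obtain ⟨z, rfl⟩ : ∃ z : ℤ_[2], (z : ℚ_[2]) = x := ⟨⟨x, hx⟩, rfl⟩
  obtain ⟨n, hn, hm⟩ := PadicInt.exists_mem_range z
  rw [IsLocalRing.mem_maximalIdeal, PadicInt.mem_nonunits] at hm
  have h := key _ hm
  rw [PadicInt.coe_sub, PadicInt.coe_natCast] at h
  interval_cases n
  · left
    simpa using h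
  · right
    simpa using h

lemma closedBall_two_padic_eq_union (n : ℕ) :
    closedBall (0 : ℚ_[2]) (2⁻¹ ^ n) =
      closedBall 0 (2⁻¹ ^ (n + 1)) ∪ closedBall (2 ^ n) (2⁻¹ ^ (n + 1)) := by
  have hpos : (0 : ℝ) < 2⁻¹ ^ n := by positivity
  have hle : (2⁻¹ : ℝ) ^ (n + 1) ≤ 2⁻¹ ^ n := by
    rw [pow_succ]
    linarith
  have h2 : ‖(2 : ℚ_[2]) ^ n‖ = 2⁻¹ ^ n := by rw [norm_pow, norm_two_padic]
  have h0 : (2 : ℚ_[2]) ^ n ≠ 0 := pow_ne_zero n two_ne_zero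
  ext x
  simp only [Set.mem_union, mem_closedBall, dist_eq_norm, sub_zero]
  constructor
  · intro hx
    have hscale (z : ℚ_[2]) (hz : ‖z‖ ≤ 2⁻¹) : ‖z * 2 ^ n‖ ≤ 2⁻¹ ^ (n + 1) := by
      rw [norm_mul, h2, pow_succ, mul_comm]
      gcongr
    have hx' : ‖x / 2 ^ n‖ ≤ 1 := by
      rw [norm_div, h2]
      exact div_le_one_of_le₀ hx hpos.le
    refine (norm_le_half_or_norm_sub_one_le_half hx').imp (fun h ↦ ?_) (fun h ↦ ?_)
    · simpa [h0] using hscale _ h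
    · simpa [h0, sub_mul] using hscale _ h
  · rintro (h | h)
    · exact h.trans hle
    · calc ‖x‖ = ‖(x - 2 ^ n) + 2 ^ n‖ := by rw [sub_add_cancel]
        _ ≤ max ‖x - 2 ^ n‖ ‖(2 : ℚ_[2]) ^ n‖ := Padic.nonarchimedean _ _
        _ ≤ 2⁻¹ ^ n := max_le (h.trans hle) h2.le

lemma disjoint_closedBall_two_padic (n : ℕ) :
    Disjoint (closedBall (0 : ℚ_[2]) (2⁻¹ ^ (n + 1))) (closedBall (2 ^ n) (2⁻¹ ^ (n + 1))) := by
  rw [Set.disjoint_left]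
  intro x hx hx'
  rw [mem_closedBall, dist_eq_norm, sub_zero] at hx
  rw [mem_closedBall, dist_eq_norm, norm_sub_rev] at hx'
  have hpos : (0 : ℝ) < 2⁻¹ ^ n := by positivity
  have h := (Padic.nonarchimedean (2 ^ n - x) x).trans (max_le hx' hx)
  rw [sub_add_cancel, norm_pow, norm_two_padic, pow_succ] at h
  linarith

lemma measureReal_closedBall_eq_zero_center [MeasurableSpace ℚ_[2]] [BorelSpace ℚ_[2]]
    (μ : Measure ℚ_[2]) [μ.IsAddHaarMeasure] (c : ℚ_[2]) (r : ℝ) :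
    μ.real (closedBall c r) = μ.real (closedBall 0 r) := by
  simp only [Measure.real, Measure.addHaar_closedBall_center]

lemma measureReal_closedBall_two_padic [MeasurableSpace ℚ_[2]] [BorelSpace ℚ_[2]]
    (μ : Measure ℚ_[2]) [μ.IsAddHaarMeasure]
    (hvol : μ {x : ℚ_[2] | ‖x‖ ≤ 1} = 1) (c : ℚ_[2]) (n : ℕ) :
    μ.real (closedBall c (2⁻¹ ^ n)) = 2⁻¹ ^ n := by
  rw [measureReal_closedBall_eq_zero_center]
  induction n with
  | zero =>
    have h : closedBall (0 : ℚ_[2]) (2⁻¹ ^ 0) = {x : ℚ_[2] | ‖x‖ ≤ 1} := by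
      ext x
      simp
    rw [Measure.real, h, hvol]
    simp
  | succ n ih =>
    rw [closedBall_two_padic_eq_union,
      measureReal_union (disjoint_closedBall_two_padic n) measurableSet_closedBall
        measure_closedBall_lt_top.ne measure_closedBall_lt_top.ne,
      measureReal_closedBall_eq_zero_center μ (2 ^ n)] at ih
    have : (2⁻¹ : ℝ) ^ (n + 1) = 2⁻¹ ^ n * 2⁻¹ := pow_succ _ _
    linarith

/-- The elements of `Y₁` of valuation `2k`. -/
def YoneShell (k : ℤ) : Set ℚ_[2] := closedBall (4 ^ k) (4 ^ (-k) * 8⁻¹)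

lemma norm_of_mem_YoneShell {k : ℤ} {y : ℚ_[2]} (hy : y ∈ YoneShell k) : ‖y‖ = 4 ^ (-k) := by
  rw [YoneShell, mem_closedBall, dist_eq_norm] at hy
  have hpos : (0 : ℝ) < 4 ^ (-k) := by positivity
  rw [Padic.norm_eq_of_norm_sub_lt_right (z2 := 4 ^ k), norm_four_zpow_padic]
  rw [norm_four_zpow_padic]
  linarith

lemma valuation_of_mem_YoneShell {k : ℤ} {y : ℚ_[2]} (hy : y ∈ YoneShell k) :
    y ≠ 0 ∧ y.valuation = 2 * k := by
  apply valuation_eq_of_norm_eq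
  rw [norm_of_mem_YoneShell hy, four_zpow_eq]
  ring_nf

lemma mem_YoneShell_iff_of_valuation {k : ℤ} {y : ℚ_[2]} (hy : y.valuation = 2 * k) :
    y ∈ YoneShell k ↔ ‖unitPart y - 1‖ ≤ 8⁻¹ := by
  have hpos : (0 : ℝ) < 4 ^ (-k) := by positivity
  have h4 : (4 : ℚ_[2]) ^ k ≠ 0 := zpow_ne_zero k (by norm_num)
  have h : y - 4 ^ k = 4 ^ k * (unitPart y - 1) := by
    rw [unitPart, hy, zpow_neg, zpow_mul, show (2 : ℚ_[2]) ^ (2 : ℤ) = 4 by norm_num]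
    field_simp
  rw [YoneShell, mem_closedBall, dist_eq_norm, h, norm_mul, norm_four_zpow_padic,
    mul_le_mul_iff_right₀ hpos]

lemma mem_Yone_iff {y : ℚ_[2]} : y ∈ Yone ↔ ∃ k, y ∈ YoneShell k := by
  constructor
  · rintro ⟨-, ⟨k, hk⟩, hu⟩
    exact ⟨k, (mem_YoneShell_iff_of_valuation (by lia)).2 hu⟩
  · rintro ⟨k, hy⟩
    obtain ⟨h0, hk⟩ := valuation_of_mem_YoneShell hy
    exact ⟨h0, ⟨k, by lia⟩, (mem_YoneShell_iff_of_valuation hk).1 hy⟩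

lemma norm_one_sub_of_pos {k : ℤ} (hk : 0 < k) {y : ℚ_[2]} (hy : y ∈ YoneShell k) :
    ‖1 - y‖ = 1 := by
  rw [← norm_one (α := ℚ_[2])]
  apply Padic.norm_eq_of_norm_sub_lt_right
  rw [sub_sub_cancel_left, norm_neg, norm_of_mem_YoneShell hy, norm_one]
  exact zpow_lt_one_of_neg₀ (by norm_num) (by lia)

lemma norm_one_sub_of_neg {k : ℤ} (hk : k < 0) {y : ℚ_[2]} (hy : y ∈ YoneShell k) :
    ‖1 - y‖ = ‖y‖ := by
  rw [norm_sub_rev]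
  apply Padic.norm_eq_of_norm_sub_lt_right
  rw [sub_sub_cancel_left, norm_neg, norm_of_mem_YoneShell hy, norm_one]
  exact one_lt_zpow₀ (by norm_num) (by lia)

lemma mem_Eset_iff_of_mem_YoneShell {k : ℤ} {y : ℚ_[2]} (hy : y ∈ YoneShell k) :
    y ∈ Eset ↔ k ≠ 0 := by
  constructor
  · rintro ⟨h1, -, hv⟩ rfl
    have h : 1 - y ≠ 0 := sub_ne_zero.2 h1.symm
    rw [YoneShell, mem_closedBall, dist_eq_norm, zpow_zero, norm_sub_rev,
      Padic.norm_eq_zpow_neg_valuation h] at hy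
    have : (2 : ℝ) ^ (-2 : ℤ) ≤ 2 ^ (-(1 - y).valuation) :=
      zpow_le_zpow_right₀ (by norm_num) (by lia)
    norm_num at this hy
    linarith
  · intro hk
    obtain ⟨n, hn, hn2, hnorm⟩ : ∃ n : ℤ, Even n ∧ n ≤ 2 ∧ ‖1 - y‖ = 2 ^ (-n) := by
      rcases hk.lt_or_gt with hk | hk
      · refine ⟨2 * k, even_two_mul k, by lia, ?_⟩
        rw [norm_one_sub_of_neg hk hy, norm_of_mem_YoneShell hy, four_zpow_eq]
        ring_nf
      · exact ⟨0, by simp, by simp, by simpa using norm_one_sub_of_pos hk hy⟩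
    obtain ⟨h0, rfl⟩ := valuation_eq_of_norm_eq hnorm
    exact ⟨(sub_ne_zero.1 h0).symm, hn, hn2⟩

lemma Eset_inter_Yone_eq : Eset ∩ Yone = ⋃ k : {k : ℤ // k ≠ 0}, YoneShell k := by
  ext y
  simp only [Set.mem_inter_iff, mem_Yone_iff, Set.mem_iUnion, Subtype.exists]
  constructor
  · rintro ⟨hE, k, hk⟩
    exact ⟨k, (mem_Eset_iff_of_mem_YoneShell hk).1 hE, hk⟩
  · rintro ⟨k, h0, hk⟩
    exact ⟨(mem_Eset_iff_of_mem_YoneShell hk).2 h0, k, hk⟩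

lemma measurableSet_YoneShell [MeasurableSpace ℚ_[2]] [BorelSpace ℚ_[2]] (k : ℤ) :
    MeasurableSet (YoneShell k) :=
  measurableSet_closedBall

lemma pairwise_disjoint_YoneShell : Pairwise (Function.onFun Disjoint YoneShell) := by
  intro j k hjk
  refine Set.disjoint_left.2 fun y hj hk ↦ hjk ?_
  have := (valuation_of_mem_YoneShell hj).2.symm.trans (valuation_of_mem_YoneShell hk).2
  lia

lemma measureReal_YoneShell [MeasurableSpace ℚ_[2]] [BorelSpace ℚ_[2]]
    (μ : Measure ℚ_[2]) [μ.IsAddHaarMeasure]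
    (hvol : μ {x : ℚ_[2] | ‖x‖ ≤ 1} = 1) (n : ℕ) :
    μ.real (YoneShell n) = 4⁻¹ ^ n * 8⁻¹ := by
  have h : (4 : ℝ) ^ (-(n : ℤ)) * 8⁻¹ = 2⁻¹ ^ (2 * n + 3) := by
    rw [zpow_neg, zpow_natCast, ← inv_pow, pow_add, pow_mul]
    norm_num
  rw [YoneShell, h, measureReal_closedBall_two_padic μ hvol, pow_add, pow_mul]
  norm_num

lemma integrand_of_pos {n : ℕ} (hn : 0 < n) {y : ℚ_[2]} (hy : y ∈ YoneShell n) :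
    Real.log (‖1 - y‖ / ‖y‖) * ‖1 - y‖⁻¹ * ‖y‖ ^ (-(1/2) : ℝ) =
      2 * n * Real.log 2 * 2 ^ n := by
  have h2 : (4 : ℝ) ^ (-(n : ℤ)) = ((2 : ℝ) ^ n) ^ (-2 : ℝ) := by
    rw [show (-2 : ℝ) = ((-2 : ℤ) : ℝ) by norm_num, Real.rpow_intCast, zpow_neg, zpow_neg,
      zpow_natCast, show (4 : ℝ) = 2 ^ 2 by norm_num, ← pow_mul, mul_comm, pow_mul]
    norm_cast
  rw [norm_one_sub_of_pos (by exact_mod_cast hn) hy, norm_of_mem_YoneShell hy, h2,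
    ← Real.rpow_mul (by positivity), one_div, Real.log_inv, Real.log_rpow (by positivity),
    Real.log_pow]
  norm_num
  ring

lemma integrand_of_neg {k : ℤ} (hk : k < 0) {y : ℚ_[2]} (hy : y ∈ YoneShell k) :
    Real.log (‖1 - y‖ / ‖y‖) * ‖1 - y‖⁻¹ * ‖y‖ ^ (-(1/2) : ℝ) = 0 := by
  rw [norm_one_sub_of_neg hk hy,
    div_self (norm_ne_zero_iff.2 (valuation_of_mem_YoneShell hy).1)]
  simp

/-- With `μ` the additive Haar measure on `ℚ₂` normalized so that `ℤ₂` has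
measure 1, `∫_{E ∩ Y₁} log(|1-y|₂/|y|₂) |1-y|₂⁻¹ |y|₂^{-1/2} dμ(y) = (1/2) log 2`. -/
theorem stmt13 [MeasurableSpace ℚ_[2]] [BorelSpace ℚ_[2]]
    (μ : Measure ℚ_[2]) [μ.IsAddHaarMeasure]
    (hvol : μ {x : ℚ_[2] | ‖x‖ ≤ 1} = 1) :
    ∫ y in Eset ∩ Yone, Real.log (‖1 - y‖ / ‖y‖) * ‖1 - y‖⁻¹ * ‖y‖ ^ (-(1/2) : ℝ) ∂μ =
      (1/2) * Real.log 2 := by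
  set f : ℚ_[2] → ℝ :=
    fun y ↦ Real.log (‖1 - y‖ / ‖y‖) * ‖1 - y‖⁻¹ * ‖y‖ ^ (-(1/2) : ℝ)
  set s : ℕ → Set ℚ_[2] := fun n ↦ YoneShell ((n + 1 : ℕ) : ℤ)
  have hsm (n : ℕ) : MeasurableSet (s n) := measurableSet_YoneShell _
  have hfs (n : ℕ) : Set.EqOn f
      (fun _ ↦ 2 * ((n + 1 : ℕ) : ℝ) * Real.log 2 * 2 ^ (n + 1)) (s n) :=
    fun y hy ↦ integrand_of_pos n.succ_pos hy
  have hint (n : ℕ) : ∫ y in s n, f y ∂μ =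
      Real.log 2 / 4 * (((n + 1 : ℕ) : ℝ) * 2⁻¹ ^ (n + 1)) := by
    rw [setIntegral_congr_fun (hsm n) (hfs n), setIntegral_const,
      measureReal_YoneShell μ hvol, smul_eq_mul, show (4⁻¹ : ℝ) = 2⁻¹ * 2⁻¹ by norm_num,
      mul_pow]
    have : (2⁻¹ : ℝ) ^ (n + 1) * 2 ^ (n + 1) = 1 := by rw [← mul_pow]; norm_num
    linear_combination (Real.log 2 / 4 * (((n + 1 : ℕ) : ℝ) * 2⁻¹ ^ (n + 1))) * this
  have hsum : HasSum (fun n ↦ ∫ y in s n, f y ∂μ) ((1/2) * Real.log 2) := by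
    simp only [hint]
    have h := hasSum_coe_mul_geometric_of_norm_lt_one (r := (2⁻¹ : ℝ)) (by norm_num)
    rw [← hasSum_nat_add_iff' 1] at h
    convert! h.mul_left (Real.log 2 / 4) using 1
    norm_num
    ring
  have hfi : IntegrableOn f (⋃ n, s n) μ := by
    refine integrableOn_iUnion_of_summable_integral_norm (fun n ↦ ?_) ?_
    · exact (integrableOn_const measure_closedBall_lt_top.ne).congr_fun (hfs n).symm (hsm n)
    · refine hsum.summable.congr fun n ↦ setIntegral_congr_fun (hsm n) fun y hy ↦ ?_
      have : 0 ≤ f y := by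
        rw [hfs n hy]
        have := Real.log_nonneg (one_le_two (α := ℝ))
        positivity
      exact (Real.norm_of_nonneg this).symm
  have hdisj : Pairwise (Function.onFun Disjoint s) := fun m n hmn ↦
    pairwise_disjoint_YoneShell (by simpa using hmn)
  have hsub : ⋃ n, s n ⊆ Eset ∩ Yone := by
    rw [Eset_inter_Yone_eq]
    exact Set.iUnion_subset fun n ↦
      Set.subset_iUnion (fun k : {k : ℤ // k ≠ 0} ↦ YoneShell k) ⟨((n + 1 : ℕ) : ℤ), by lia⟩
  have hmeas : MeasurableSet (Eset ∩ Yone) := by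
    rw [Eset_inter_Yone_eq]
    exact MeasurableSet.iUnion fun k ↦ measurableSet_YoneShell k
  rw [setIntegral_eq_of_subset_of_forall_sdiff_eq_zero hmeas hsub]
  · exact (hasSum_integral_iUnion hsm hdisj hfi).unique hsum
  · rintro y ⟨hy, hns⟩
    rw [Eset_inter_Yone_eq, Set.mem_iUnion] at hy
    obtain ⟨⟨k, hk0⟩, hk⟩ := hy
    rcases hk0.lt_or_gt with hneg | hpos
    · exact integrand_of_neg hneg hk
    · obtain ⟨n, rfl⟩ : ∃ n : ℕ, k = ((n + 1 : ℕ) : ℤ) := ⟨(k - 1).toNat, by lia⟩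
      exact absurd (Set.mem_iUnion.2 ⟨n, hk⟩) hns
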